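/- arXiv:2108.06754 — 2 statements merged into one kernel-verified Lean document; each statement's English description precedes it below -/
import Mathlib

section
/- Let φ₁,…,φ_n (n ≥ 1) be multiplicative characters of the finite field κ. If (φ₁,…,φ_n) ≠ (ε,…,ε), then j(φ₁,…,φ_n) = g(φ₁)⋯g(φ_n) / g°(φ₁⋯φ_n). If φ₁ = ⋯ = φ_n = ε, then j(ε,…,ε) = (1 − (1−q)^n)/q. -/
/-!
Finite-field hypergeometric functions (Otsubo), basic definitions:
`κ` is a finite field with `q = Fintype.card κ` elements, `ψ` a fixed nontrivial
additive character, multiplicative characters are `MulChar κ ℂ` (extended by `0`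
on `0`, with trivial character `1`).
-/

open scoped Classical

noncomputable section

variable {κ : Type*} [Field κ] [Fintype κ]

instance : Fintype (MulChar κ ℂ) := Fintype.ofFinite _

/-- The Gauss sum `g(φ) = -∑_{x ∈ κ} ψ(x) φ(x)`. -/
def gS (ψ : AddChar κ ℂ) (φ : MulChar κ ℂ) : ℂ := -∑ x : κ, ψ x * φ x

/-- The variant `g°(φ) = q^{δ(φ)} · g(φ)`, where `δ(φ) = 1` iff `φ` is trivial. -/
def gSo (ψ : AddChar κ ℂ) (φ : MulChar κ ℂ) : ℂ :=
  (if φ = 1 then (Fintype.card κ : ℂ) else 1) * gS ψ φ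

/-- The Pochhammer symbol `(α)_ν = g(αν)/g(α)`. -/
def poch (ψ : AddChar κ ℂ) (α ν : MulChar κ ℂ) : ℂ := gS ψ (α * ν) / gS ψ α

/-- The variant Pochhammer symbol `(α)°_ν = g°(αν)/g°(α)`. -/
def pocho (ψ : AddChar κ ℂ) (α ν : MulChar κ ℂ) : ℂ := gSo ψ (α * ν) / gSo ψ α

/-- The `n`-ary Jacobi sum
`j(φ₁,…,φ_n) = (-1)^{n-1} ∑_{x₁+⋯+x_n=1} φ₁(x₁)⋯φ_n(x_n)`. -/
def jacn {n : ℕ} (φ : Fin n → MulChar κ ℂ) : ℂ :=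
  (-1) ^ (n - 1) *
    ∑ x ∈ Finset.univ.filter (fun x : Fin n → κ => ∑ i, x i = 1), ∏ i, φ i (x i)

/-- The fibre over `a` of the sum map, weighted by the characters `φ i`. -/
def fibreSum {n : ℕ} (φ : Fin n → MulChar κ ℂ) (a : κ) : ℂ :=
  ∑ x ∈ Finset.univ.filter (fun x : Fin n → κ => ∑ i, x i = a), ∏ i, φ i (x i)

theorem mulChar_prod_apply {F : Type*} [Field F] {n : ℕ} (φ : Fin n → MulChar F ℂ) {a : F}
    (ha : a ≠ 0) : (∏ i, φ i) a = ∏ i, φ i a := by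
  induction n with
  | zero => simp [MulChar.one_apply (isUnit_iff_ne_zero.mpr ha)]
  | succ n ih => rw [Fin.prod_univ_succ, Fin.prod_univ_succ, MulChar.mul_apply, ih]

theorem fibreSum_of_ne_zero {n : ℕ} (φ : Fin n → MulChar κ ℂ) {a : κ} (ha : a ≠ 0) :
    fibreSum φ a = (∏ i, φ i) a * fibreSum φ 1 := by
  rw [fibreSum, fibreSum, Finset.mul_sum]
  refine Finset.sum_nbij' (fun x i => a⁻¹ * x i) (fun x i => a * x i) ?_ ?_ ?_ ?_ ?_
  · intro x hx
    simp only [Finset.mem_filter, Finset.mem_univ, true_and] at hx ⊢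
    rw [← Finset.mul_sum, hx, inv_mul_cancel₀ ha]
  · intro x hx
    simp only [Finset.mem_filter, Finset.mem_univ, true_and] at hx ⊢
    rw [← Finset.mul_sum, hx, mul_one]
  · intro x _
    simp [ha]
  · intro x _
    simp [ha]
  · intro x _
    rw [mulChar_prod_apply φ ha, ← Finset.prod_mul_distrib]
    refine Finset.prod_congr rfl fun i _ => ?_
    rw [← map_mul, mul_inv_cancel_left₀ ha]

/-- A product of Gauss sums, for an arbitrary additive character, in terms of fibre sums. -/
theorem prod_gaussSum_eq {n : ℕ} (φ : Fin n → MulChar κ ℂ) (ψ : AddChar κ ℂ) :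
    ∏ i, gaussSum (φ i) ψ = fibreSum φ 0 + fibreSum φ 1 * gaussSum (∏ i, φ i) ψ := by
  have h : ∏ i, gaussSum (φ i) ψ = ∑ a, fibreSum φ a * ψ a := by
    simp only [gaussSum, Finset.prod_univ_sum, Fintype.piFinset_univ, Finset.prod_mul_distrib,
      fibreSum, Finset.sum_mul]
    rw [← Finset.sum_fiberwise (s := Finset.univ) (g := fun x : Fin n → κ => ∑ i, x i)]
    refine Finset.sum_congr rfl fun a _ => Finset.sum_congr rfl fun x hx => ?_
    rw [← (Finset.mem_filter.mp hx).2]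
    exact congrArg _ (map_prod ψ.toMonoidHom (fun i => Multiplicative.ofAdd (x i)) _).symm
  have h0 : (∏ i, φ i) (0 : κ) = 0 := MulChar.map_zero _
  rw [h, gaussSum, Finset.mul_sum, ← Finset.add_sum_erase _ _ (Finset.mem_univ (0 : κ)),
    ← Finset.add_sum_erase _ (fun a => fibreSum φ 1 * ((∏ i, φ i) a * ψ a))
      (Finset.mem_univ (0 : κ)), h0, AddChar.map_zero_eq_one]
  simp only [mul_one, mul_zero, zero_add]
  congr 1
  refine Finset.sum_congr rfl fun a ha => ?_
  rw [fibreSum_of_ne_zero φ (Finset.ne_of_mem_erase ha)]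
  ring

theorem gaussSum_one_one_eq_card_sub_one :
    gaussSum (1 : MulChar κ ℂ) 1 = (Fintype.card κ : ℂ) - 1 := by
  rw [gaussSum_one_one, Nat.card_eq_fintype_card, Fintype.card_units,
    Nat.cast_sub Fintype.card_pos, Nat.cast_one]

theorem gS_eq_neg_gaussSum (ψ : AddChar κ ℂ) (χ : MulChar κ ℂ) :
    gS ψ χ = -gaussSum χ ψ := by
  simp only [gS, gaussSum, mul_comm]

theorem gSo_ne_zero {ψ : AddChar κ ℂ} (hψ : ψ ≠ 1) (χ : MulChar κ ℂ) : gSo ψ χ ≠ 0 := by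
  have hq : (Fintype.card κ : ℂ) ≠ 0 := Nat.cast_ne_zero.mpr Fintype.card_ne_zero
  rw [gSo, gS_eq_neg_gaussSum]
  split_ifs with h
  · simp [h, gaussSum_one_left hψ, hq]
  · simpa using gaussSum_ne_zero_of_nontrivial hq h (AddChar.IsPrimitive.of_ne_one hψ)

/-- `g°(χ)` is, up to sign, the difference of Gauss sums for `ψ` and the trivial character. -/
theorem gSo_eq_sub {ψ : AddChar κ ℂ} (hψ : ψ ≠ 1) (χ : MulChar κ ℂ) :
    gSo ψ χ = gaussSum χ 1 - gaussSum χ ψ := by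
  rw [gSo, gS_eq_neg_gaussSum]
  split_ifs with h
  · rw [h, gaussSum_one_left hψ, gaussSum_one_one_eq_card_sub_one]
    ring
  · rw [gaussSum_one_right h]
    ring

/-- The product of Gauss sums is `g°` of the product times the Jacobi sum, up to a correction
that vanishes unless all the characters are trivial. -/
theorem prod_gS_eq {ψ : AddChar κ ℂ} (hψ : ψ ≠ 1) {n : ℕ} (hn : 1 ≤ n)
    (φ : Fin n → MulChar κ ℂ) :
    ∏ i, gS ψ (φ i) = ∏ i, (-gaussSum (φ i) 1) + jacn φ * gSo ψ (∏ i, φ i) := by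
  obtain ⟨m, rfl⟩ := Nat.exists_eq_add_of_le' hn
  have hj : jacn φ = (-1) ^ m * fibreSum φ 1 := rfl
  simp only [gS_eq_neg_gaussSum, Finset.prod_neg, Finset.card_univ, Fintype.card_fin,
    prod_gaussSum_eq φ, gSo_eq_sub hψ, hj]
  ring

/-- if `(φ₁,…,φ_n) ≠ (ε,…,ε)` then
`j(φ₁,…,φ_n) = g(φ₁)⋯g(φ_n)/g°(φ₁⋯φ_n)`, and
`j(ε,…,ε) = (1-(1-q)^n)/q`. -/
theorem stmt_1 (ψ : AddChar κ ℂ) (hψ : ψ ≠ 1) {n : ℕ} (hn : 1 ≤ n)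
    (φ : Fin n → MulChar κ ℂ) :
    (¬ (∀ i, φ i = 1) →
      jacn φ = (∏ i, gS ψ (φ i)) / gSo ψ (∏ i, φ i)) ∧
    ((∀ i, φ i = 1) →
      jacn φ = (1 - (1 - (Fintype.card κ : ℂ)) ^ n) / (Fintype.card κ : ℂ)) := by
  have key := prod_gS_eq hψ hn φ
  refine ⟨fun h => ?_, fun h => ?_⟩
  · obtain ⟨i, hi⟩ := not_forall.mp h
    rw [eq_div_iff (gSo_ne_zero hψ _), key,
      Finset.prod_eq_zero (Finset.mem_univ i) (by rw [gaussSum_one_right hi, neg_zero]), zero_add]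
  · have hq : (Fintype.card κ : ℂ) ≠ 0 := Nat.cast_ne_zero.mpr Fintype.card_ne_zero
    simp only [h, gS_eq_neg_gaussSum, gaussSum_one_left hψ, gaussSum_one_one_eq_card_sub_one,
      gSo, Finset.prod_const, Finset.card_univ, Fintype.card_fin, one_pow, if_true, neg_neg,
      neg_sub, mul_one] at key
    rw [eq_div_iff hq]
    linear_combination -key

end
end

section
/- For all finite tuples 𝛂 = (α₁,…,α_m) and 𝛃 = (β₁,…,β_n) of multiplicative characters of κ, every finite tuple 𝛄 = (γ₁,…,γ_k) of multiplicative characters of κ, and every λ ∈ κ: F(𝛂⌢𝛄, 𝛃⌢𝛄; λ) = q^{m_ε(𝛄)} · ( F(𝛂,𝛃;λ) + q⁻¹ · ∑_ν [(1 − q^{−m_ν(𝛄)})/(1 − q⁻¹)] · [∏_{i=1}^m (α_i)_{ν̄} / ∏_{j=1}^n (β_j)°_{ν̄}] · ν̄(λ) ), where 𝛂⌢𝛄 denotes the concatenation of tuples, m_ν(𝛄) = #{ i : γ_i = ν }, and the outer sum runs over all multiplicative characters ν of κ. -/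
/-!
Finite-field hypergeometric functions (Otsubo), basic definitions:
`κ` is a finite field with `q = Fintype.card κ` elements, `ψ` a fixed nontrivial
additive character, multiplicative characters are `MulChar κ ℂ` (extended by `0`
on `0`, with trivial character `1`).
-/

open scoped Classical

noncomputable section

variable {κ : Type*} [Field κ] [Fintype κ]

/-- The finite hypergeometric function for tuples `𝛂`, `𝛃` of multiplicative characters:
`F(𝛂,𝛃;λ) = (1/(1-q)) ∑_ν (∏ᵢ (αᵢ)_ν / ∏ⱼ (βⱼ)°_ν) ν(λ)`. -/
def FhT (ψ : AddChar κ ℂ) {m n : ℕ} (A : Fin m → MulChar κ ℂ) (B : Fin n → MulChar κ ℂ)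
    (l : κ) : ℂ :=
  (1 - (Fintype.card κ : ℂ))⁻¹ *
    ∑ ν : MulChar κ ℂ, ((∏ i, poch ψ (A i) ν) / ∏ j, pocho ψ (B j) ν) * ν l

/-- Gauss sums for a nontrivial additive character never vanish. -/
theorem gS_ne_zero {ψ : AddChar κ ℂ} (hψ : ψ ≠ 1) (φ : MulChar κ ℂ) : gS ψ φ ≠ 0 := by
  have h : gS ψ φ = -gaussSum φ ψ := by simp only [gS, gaussSum, mul_comm]
  rw [h, neg_ne_zero]
  by_cases hφ : φ = 1
  · simp [hφ, gaussSum_one_left hψ]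
  · exact gaussSum_ne_zero_of_nontrivial (Nat.cast_ne_zero.mpr Fintype.card_ne_zero) hφ
      (AddChar.IsPrimitive.of_ne_one hψ)

theorem poch_div_pocho {ψ : AddChar κ ℂ} (hψ : ψ ≠ 1) (γ ν : MulChar κ ℂ) :
    poch ψ γ ν / pocho ψ γ ν =
      (if γ = 1 then (Fintype.card κ : ℂ) else 1) /
        (if γ = ν⁻¹ then (Fintype.card κ : ℂ) else 1) := by
  have h₁ := gS_ne_zero hψ γ
  have h₂ := gS_ne_zero hψ (γ * ν)
  simp only [poch, pocho, gSo, mul_eq_one_iff_eq_inv]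
  field_simp

theorem prod_poch_div_prod_pocho {ψ : AddChar κ ℂ} (hψ : ψ ≠ 1) {k : ℕ}
    (C : Fin k → MulChar κ ℂ) (ν : MulChar κ ℂ) :
    (∏ i, poch ψ (C i) ν) / ∏ i, pocho ψ (C i) ν =
      (Fintype.card κ : ℂ) ^ (Finset.univ.filter fun i => C i = 1).card *
        (Fintype.card κ : ℂ) ^ (-((Finset.univ.filter fun i => C i = ν⁻¹).card : ℤ)) := by
  simp_rw [← Finset.prod_div_distrib, poch_div_pocho hψ, Finset.prod_div_distrib,
    Finset.prod_ite, Finset.prod_const, one_pow, mul_one, zpow_neg, zpow_natCast, div_eq_mul_inv]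

/-- reduction formula: for tuples `𝛂`, `𝛃`, `𝛄` and `λ ∈ κ`,
`F(𝛂⌢𝛄,𝛃⌢𝛄;λ) = q^{m_ε(𝛄)} (F(𝛂,𝛃;λ) + q⁻¹ ∑_ν ((1-q^{-m_ν(𝛄)})/(1-q⁻¹)) ·
  (∏ᵢ (αᵢ)_{ν̄} / ∏ⱼ (βⱼ)°_{ν̄}) ν̄(λ))`,
where `m_ν(𝛄) = #{i : γᵢ = ν}`. -/
theorem stmt_3 (ψ : AddChar κ ℂ) (hψ : ψ ≠ 1) {m n k : ℕ}
    (A : Fin m → MulChar κ ℂ) (B : Fin n → MulChar κ ℂ) (C : Fin k → MulChar κ ℂ)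
    (l : κ) :
    FhT ψ (Fin.append A C) (Fin.append B C) l =
      (Fintype.card κ : ℂ) ^ (Finset.univ.filter fun i => C i = 1).card *
        (FhT ψ A B l + (Fintype.card κ : ℂ)⁻¹ *
          ∑ ν : MulChar κ ℂ,
            ((1 - (Fintype.card κ : ℂ) ^
                (-((Finset.univ.filter fun i => C i = ν).card : ℤ))) /
              (1 - (Fintype.card κ : ℂ)⁻¹)) *
            ((∏ i, poch ψ (A i) ν⁻¹) / ∏ j, pocho ψ (B j) ν⁻¹) * ν⁻¹ l) := by
  have hq : (Fintype.card κ : ℂ) ≠ 0 := Nat.cast_ne_zero.mpr Fintype.card_ne_zero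
  have hq₁ : (Fintype.card κ : ℂ) ≠ 1 := by exact_mod_cast (Fintype.one_lt_card (α := κ)).ne'
  rw [← Equiv.sum_comp (Equiv.inv (MulChar κ ℂ))]
  simp only [FhT, Equiv.inv_apply, inv_inv, Fin.prod_univ_add, Fin.append_left, Fin.append_right]
  simp only [Finset.mul_sum, ← Finset.sum_add_distrib]
  refine Finset.sum_congr rfl fun ν _ => ?_
  rw [mul_div_mul_comm, prod_poch_div_prod_pocho hψ]
  generalize (Fintype.card κ : ℂ) ^ (-((Finset.univ.filter fun i => C i = ν⁻¹).card : ℤ)) = z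
  generalize (∏ i, poch ψ (A i) ν) / ∏ j, pocho ψ (B j) ν = T
  have h₁ : 1 - (Fintype.card κ : ℂ) ≠ 0 := sub_ne_zero.mpr hq₁.symm
  have h₂ : (Fintype.card κ : ℂ)⁻¹ * ((1 - z) / (1 - (Fintype.card κ : ℂ)⁻¹)) =
      -((1 - (Fintype.card κ : ℂ))⁻¹ * (1 - z)) := by
    have h₃ : (Fintype.card κ : ℂ) - 1 ≠ 0 := sub_ne_zero.mpr hq₁
    field_simp
    ring
  linear_combination
    -(Fintype.card κ : ℂ) ^ (Finset.univ.filter fun i => C i = 1).card * T * ν l * h₂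

end
end
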